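/- Let n ≥ 2, d ≥ 1, let a_1,…,a_n, b_1,…,b_n ∈ {0,1}^d be binary vectors, let t ≥ 1 be an integer, and let μ ≥ 0. Set C = 2 ln(n + 2μ) and, for each i ∈ [n], define Y_i = Σ_{j=1}^n exp(C · a_i^T b_j). Suppose Ŷ_1,…,Ŷ_n are real numbers with |Ŷ_i − Y_i| ≤ μ for all i ∈ [n]. Then there exist i, j ∈ [n] with a_i^T b_j ≥ t if and only if there exists i ∈ [n] with Ŷ_i > n · exp(C(t−1)) + μ. -/

import Mathlib

open Finset Real

/-- Dot product of two real vectors. -/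
noncomputable def dotp {d : ℕ} (x y : Fin d → ℝ) : ℝ := ∑ r, x r * y r

/-- Case analysis (element-wise additive approximation) underlying the
reduction from TVPP to exponential dot-product self-attention (Theorem 1). -/
theorem tvpp_exp_dot_product_add_approx (n d t : ℕ) (hn : 2 ≤ n) (hd : 1 ≤ d) (ht : 1 ≤ t)
    (a b : Fin n → Fin d → ℝ)
    (ha : ∀ i r, a i r = 0 ∨ a i r = 1) (hb : ∀ i r, b i r = 0 ∨ b i r = 1)
    (μ : ℝ) (hμ0 : 0 ≤ μ)
    (C : ℝ) (hC : C = 2 * Real.log ((n : ℝ) + 2 * μ))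
    (Y : Fin n → ℝ)
    (hY : ∀ i, Y i = ∑ j, Real.exp (C * dotp (a i) (b j)))
    (Yhat : Fin n → ℝ)
    (hYhat : ∀ i, |Yhat i - Y i| ≤ μ) :
    (∃ i j, (t : ℝ) ≤ dotp (a i) (b j)) ↔
      (∃ i, Yhat i > (n : ℝ) * Real.exp (C * ((t : ℝ) - 1)) + μ) := by
  have hn' : (2 : ℝ) ≤ n := by exact_mod_cast hn
  have ht' : (1 : ℝ) ≤ t := by exact_mod_cast ht
  have hN : 2 ≤ (n : ℝ) + 2 * μ := by linarith
  have hC0 : 0 ≤ C := by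
    rw [hC]
    have := Real.log_nonneg (by linarith : 1 ≤ (n : ℝ) + 2 * μ)
    linarith
  have hexpC : Real.exp C = ((n : ℝ) + 2 * μ) ^ 2 := by
    rw [hC, two_mul, Real.exp_add, Real.exp_log (by linarith)]
    ring
  have hE : 1 ≤ Real.exp (C * ((t : ℝ) - 1)) :=
    Real.one_le_exp (mul_nonneg hC0 (by linarith))
  constructor
  · rintro ⟨i, j, hij⟩
    refine ⟨i, ?_⟩
    have h1 : Real.exp (C * t) ≤ Y i := by
      rw [hY]
      refine le_trans (Real.exp_le_exp.2 (mul_le_mul_of_nonneg_left hij hC0)) ?_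
      exact Finset.single_le_sum (f := fun j => Real.exp (C * dotp (a i) (b j)))
        (fun k _ => (Real.exp_pos _).le) (Finset.mem_univ j)
    have h2 : Real.exp (C * t) = ((n : ℝ) + 2 * μ) ^ 2 * Real.exp (C * ((t : ℝ) - 1)) := by
      rw [← hexpC, ← Real.exp_add]
      congr 1
      ring
    have h3 := (abs_le.1 (hYhat i)).1
    set E := Real.exp (C * ((t : ℝ) - 1))
    have h4 : ((n : ℝ) + 2 * μ) * E < ((n : ℝ) + 2 * μ) ^ 2 * E := by
      apply mul_lt_mul_of_pos_right _ (by linarith)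
      nlinarith
    have h5 : 2 * μ ≤ 2 * μ * E := le_mul_of_one_le_right (by linarith) hE
    have h6 : ((n : ℝ) + 2 * μ) * E = n * E + 2 * μ * E := by ring
    linarith
  · rintro ⟨i, hi⟩
    by_contra hcon
    push Not at hcon
    have hint : ∀ j, dotp (a i) (b j) ≤ (t : ℝ) - 1 := by
      intro j
      have hk : ∃ k : ℤ, dotp (a i) (b j) = k := by
        refine ⟨∑ r, (if a i r = 1 ∧ b j r = 1 then 1 else 0), ?_⟩
        unfold dotp
        push_cast
        refine Finset.sum_congr rfl fun r _ => ?_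
        rcases ha i r with h | h <;> rcases hb j r with h' | h' <;> simp [h, h']
      obtain ⟨k, hk⟩ := hk
      have hlt := hcon i j
      rw [hk] at hlt ⊢
      have h7 : k < (t : ℤ) := by exact_mod_cast hlt
      have h8 : k ≤ (t : ℤ) - 1 := by omega
      exact_mod_cast h8
    have hYi : Y i ≤ n * Real.exp (C * ((t : ℝ) - 1)) := by
      rw [hY]
      refine (Finset.sum_le_card_nsmul _ _ (Real.exp (C * ((t : ℝ) - 1))) fun j _ =>
        Real.exp_le_exp.2 (mul_le_mul_of_nonneg_left (hint j) hC0)).trans ?_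
      simp
    have h3 := (abs_le.1 (hYhat i)).2
    linarith
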